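/- Let V : ℝ^N → ℝ satisfy V(x) ≥ V₀ > 0 for all x, let k > 1, and let a > 0 satisfy max{ f(a)/a , f(−a)/(−a) } ≤ V₀/k. Then the penalized nonlinearity g satisfies (g₃): for every x ∈ Ω and s ≠ 0, 0 < μ G(x,s) ≤ s g(x,s); and for every x ∉ Ω and s ≠ 0, 0 < 2 G(x,s) ≤ s g(x,s) ≤ (1/k) V(x) s². -/

import Mathlib

open Set

/-- The truncation `f̃` of `f` at level `a`. -/
noncomputable def ftrunc (f : ℝ → ℝ) (a : ℝ) : ℝ → ℝ := fun s =>
  if s < -a then (f (-a) / (-a)) * s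
  else if s ≤ a then f s
  else (f a / a) * s

-- The penalized nonlinearity `g`.
open Classical in
noncomputable def gpen {N : ℕ} (f : ℝ → ℝ) (a : ℝ)
    (Ω : Set (EuclideanSpace ℝ (Fin N))) :
    EuclideanSpace ℝ (Fin N) → ℝ → ℝ := fun x s =>
  if x ∈ Ω then f s else ftrunc f a s

/-- The primitive `G(x,s) = ∫₀ˢ g(x,t) dt`. -/
noncomputable def Gpen {N : ℕ} (f : ℝ → ℝ) (a : ℝ)
    (Ω : Set (EuclideanSpace ℝ (Fin N))) :
    EuclideanSpace ℝ (Fin N) → ℝ → ℝ := fun x s =>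
  ∫ t in (0 : ℝ)..s, gpen f a Ω x t

theorem ftrunc_div_self_of_pos (f : ℝ → ℝ) {a s : ℝ} (ha : 0 < a) (hs : 0 < s) :
    ftrunc f a s / s = f (min s a) / min s a := by
  have h₁ : ¬ s < -a := by linarith
  rcases le_or_gt s a with h | h
  · simp [ftrunc, h₁, h]
  · simp [ftrunc, h₁, h.not_ge, min_eq_right h.le, hs.ne']

theorem ftrunc_div_self_of_neg (f : ℝ → ℝ) {a s : ℝ} (ha : 0 < a) (hs : s < 0) :
    ftrunc f a s / s = f (max s (-a)) / max s (-a) := by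
  have h₁ : s ≤ a := by linarith
  rcases lt_or_ge s (-a) with h | h
  · rw [max_eq_right h.le]
    simp only [ftrunc, if_pos h]
    exact mul_div_cancel_right₀ _ hs.ne
  · simp [ftrunc, h₁, h.not_gt, max_eq_left h]

theorem continuous_ftrunc {f : ℝ → ℝ} (hf : Continuous f) {a : ℝ} (ha : 0 < a) :
    Continuous (ftrunc f a) := by
  have hinner : Continuous fun s => if s ≤ a then f s else f a / a * s :=
    hf.if_le (by fun_prop) continuous_id continuous_const
      (by rintro s rfl; exact (div_mul_cancel₀ _ ha.ne').symm)
  have houter : Continuous fun s =>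
      if -a ≤ s then (if s ≤ a then f s else f a / a * s) else f (-a) / (-a) * s := by
    refine hinner.if_le (by fun_prop) continuous_const continuous_id ?_
    rintro s rfl
    rw [if_pos (by linarith), div_mul_cancel₀ _ (neg_ne_zero.mpr ha.ne')]
  convert houter using 2 with s
  by_cases h : s < -a
  · simp only [ftrunc, if_pos h, if_neg h.not_ge]
  · simp only [ftrunc, if_neg h, if_pos (not_lt.mp h)]

/-- If `h t / t` is positive and nondecreasing on `(0, ∞)`, then `0 < 2 H(s) ≤ s h(s)` for `s > 0`,
where `H` is the primitive of `h`. -/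
theorem two_mul_integral_le_of_monotoneOn_div {h : ℝ → ℝ} (hc : Continuous h)
    (hpos : ∀ t, 0 < t → 0 < h t / t) (hmono : MonotoneOn (fun t => h t / t) (Ioi 0))
    {s : ℝ} (hs : 0 < s) :
    0 < 2 * (∫ t in (0 : ℝ)..s, h t) ∧ 2 * (∫ t in (0 : ℝ)..s, h t) ≤ s * h s := by
  constructor
  · refine mul_pos two_pos (intervalIntegral.intervalIntegral_pos_of_pos_on
      (hc.intervalIntegrable _ _) (fun t ht => ?_) hs)
    exact (div_pos_iff_of_pos_right ht.1).mp (hpos t ht.1)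
  · have hle : (∫ t in (0 : ℝ)..s, h t) ≤ ∫ t in (0 : ℝ)..s, h s / s * t := by
      refine intervalIntegral.integral_mono_on_of_le_Ioo hs.le (hc.intervalIntegrable _ _)
        ((continuous_const.mul continuous_id).intervalIntegrable _ _) fun t ht => ?_
      exact (div_le_iff₀ ht.1).mp (hmono ht.1 (mem_Ioi.mpr hs) ht.2.le)
    rw [intervalIntegral.integral_const_mul, integral_id] at hle
    have hval : 2 * (h s / s * ((s ^ 2 - 0 ^ 2) / 2)) = s * h s := by
      field_simp
      ring
    linarith

/-- The version of `two_mul_integral_le_of_monotoneOn_div` on the negative half-line. -/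
theorem two_mul_integral_le_of_antitoneOn_div {h : ℝ → ℝ} (hc : Continuous h)
    (hpos : ∀ t, t < 0 → 0 < h t / t) (hanti : AntitoneOn (fun t => h t / t) (Iio 0))
    {s : ℝ} (hs : s < 0) :
    0 < 2 * (∫ t in (0 : ℝ)..s, h t) ∧ 2 * (∫ t in (0 : ℝ)..s, h t) ≤ s * h s := by
  have hdiv (t : ℝ) : -h (-t) / t = h (-t) / (-t) := by rw [div_neg, neg_div]
  have key := two_mul_integral_le_of_monotoneOn_div (h := fun t => -h (-t)) (by fun_prop)
    (fun t ht => by rw [hdiv]; exact hpos _ (neg_lt_zero.mpr ht))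
    (fun x hx y hy hxy => by
      simp only [hdiv]
      exact hanti (mem_Iio.mpr (neg_lt_zero.mpr hy)) (mem_Iio.mpr (neg_lt_zero.mpr hx))
        (neg_le_neg hxy))
    (neg_pos.mpr hs)
  rw [intervalIntegral.integral_neg, intervalIntegral.integral_comp_neg, neg_neg, neg_zero,
    ← intervalIntegral.integral_symm, neg_mul_neg] at key
  exact key

/-- Let `V : ℝ^N → ℝ` satisfy `V(x) ≥ V₀ > 0` for all `x`, let `k > 1`,
and let `a > 0` satisfy `max (f a / a) (f (-a) / (-a)) ≤ V₀ / k`. Then the penalized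
nonlinearity `g` satisfies (g₃): for every `x ∈ Ω` and `s ≠ 0`,
`0 < μ G(x,s) ≤ s g(x,s)`; and for every `x ∉ Ω` and `s ≠ 0`,
`0 < 2 G(x,s) ≤ s g(x,s) ≤ (1/k) V(x) s²`. -/
theorem gpen_g3
    {N : ℕ} (f : ℝ → ℝ) (hf : Continuous f)
    (F : ℝ → ℝ) (hF : ∀ s : ℝ, F s = ∫ t in (0 : ℝ)..s, f t)
    (μ : ℝ) (hμ : 2 < μ)
    (hAR : ∀ s : ℝ, s ≠ 0 → 0 < μ * F s ∧ μ * F s ≤ s * f s)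
    (hmono : StrictMonoOn (fun s => f s / s) (Ioi (0 : ℝ)))
    (hanti : StrictAntiOn (fun s => f s / s) (Iio (0 : ℝ)))
    (Ω : Set (EuclideanSpace ℝ (Fin N)))
    (V : EuclideanSpace ℝ (Fin N) → ℝ) (V₀ : ℝ) (hV₀ : 0 < V₀)
    (hV : ∀ x, V₀ ≤ V x) (k : ℝ) (hk : 1 < k)
    (a : ℝ) (ha : 0 < a) (haK : max (f a / a) (f (-a) / (-a)) ≤ V₀ / k) :
    (∀ x ∈ Ω, ∀ s : ℝ, s ≠ 0 →
      0 < μ * Gpen f a Ω x s ∧ μ * Gpen f a Ω x s ≤ s * gpen f a Ω x s) ∧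
    (∀ x ∉ Ω, ∀ s : ℝ, s ≠ 0 →
      0 < 2 * Gpen f a Ω x s ∧ 2 * Gpen f a Ω x s ≤ s * gpen f a Ω x s ∧
        s * gpen f a Ω x s ≤ (1 / k) * V x * s ^ 2) := by
  have hfpos (s : ℝ) (hs : s ≠ 0) : 0 < f s / s := by
    have : 0 < s * f s := (hAR s hs).1.trans_le (hAR s hs).2
    rw [← mul_div_mul_left _ _ hs]
    exact div_pos this (mul_self_pos.mpr hs)
  refine ⟨fun x hx s hs => ?_, fun x hx s hs => ?_⟩
  · simpa only [Gpen, gpen, if_pos hx, ← hF] using hAR s hs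
  · simp only [Gpen, gpen, if_neg hx]
    have hc := continuous_ftrunc hf ha
    suffices H : (0 < 2 * (∫ t in (0 : ℝ)..s, ftrunc f a t) ∧
        2 * (∫ t in (0 : ℝ)..s, ftrunc f a t) ≤ s * ftrunc f a s) ∧
        ftrunc f a s / s ≤ V₀ / k by
      refine ⟨H.1.1, H.1.2, ?_⟩
      have hV' : ftrunc f a s / s ≤ 1 / k * V x := by
        rw [one_div_mul_eq_div]
        exact H.2.trans (div_le_div_of_nonneg_right (hV x) (by linarith))
      calc s * ftrunc f a s = ftrunc f a s / s * s ^ 2 := by field_simp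
        _ ≤ 1 / k * V x * s ^ 2 := mul_le_mul_of_nonneg_right hV' (sq_nonneg s)
    rcases hs.lt_or_gt with hs | hs
    · have hclamp {t : ℝ} (ht : t < 0) : max t (-a) < 0 := max_lt ht (neg_lt_zero.mpr ha)
      refine ⟨two_mul_integral_le_of_antitoneOn_div hc (fun t ht => ?_)
        (fun t ht u hu htu => ?_) hs, ?_⟩
      · rw [ftrunc_div_self_of_neg f ha ht]
        exact hfpos _ (hclamp ht).ne
      · simp only [ftrunc_div_self_of_neg f ha ht, ftrunc_div_self_of_neg f ha hu]
        exact hanti.antitoneOn (hclamp ht) (hclamp hu) (max_le_max_right _ htu)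
      · rw [ftrunc_div_self_of_neg f ha hs]
        exact (hanti.antitoneOn (mem_Iio.mpr (neg_lt_zero.mpr ha)) (hclamp hs)
          (le_max_right _ _)).trans ((le_max_right _ _).trans haK)
    · have hclamp {t : ℝ} (ht : 0 < t) : 0 < min t a := lt_min ht ha
      refine ⟨two_mul_integral_le_of_monotoneOn_div hc (fun t ht => ?_)
        (fun t ht u hu htu => ?_) hs, ?_⟩
      · rw [ftrunc_div_self_of_pos f ha ht]
        exact hfpos _ (hclamp ht).ne'
      · simp only [ftrunc_div_self_of_pos f ha ht, ftrunc_div_self_of_pos f ha hu]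
        exact hmono.monotoneOn (hclamp ht) (hclamp hu) (min_le_min_right _ htu)
      · rw [ftrunc_div_self_of_pos f ha hs]
        exact (hmono.monotoneOn (hclamp hs) (mem_Ioi.mpr ha)
          (min_le_right _ _)).trans ((le_max_left _ _).trans haK)
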